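/- Let n ≥ 2, r > 0, and let f be a C² real-valued function on the closed ball B̄_r ⊂ ℝⁿ whose mean curvature does not change sign, i.e. either H(x) ≥ 0 for all x ∈ B̄_r or H(x) ≤ 0 for all x ∈ B̄_r. Then inf_{x∈B̄_r} |A|(x) < n/r, where |A|(x) = √(tr(W(x)²)). -/

import Mathlib

open Metric Finset

/-- Coordinates of the gradient of `f` at `x`. -/
noncomputable def grad (n : ℕ) (f : EuclideanSpace ℝ (Fin n) → ℝ)
    (x : EuclideanSpace ℝ (Fin n)) : Fin n → ℝ :=
  fun i => fderiv ℝ f x (EuclideanSpace.single i 1)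

/-- The Hessian matrix `D²f(x)`. -/
noncomputable def hess (n : ℕ) (f : EuclideanSpace ℝ (Fin n) → ℝ)
    (x : EuclideanSpace ℝ (Fin n)) : Matrix (Fin n) (Fin n) ℝ :=
  Matrix.of fun i j =>
    fderiv ℝ (fun y => fderiv ℝ f y (EuclideanSpace.single j 1)) x (EuclideanSpace.single i 1)

/-- `|∇f(x)|²`. -/
noncomputable def gradSq (n : ℕ) (f : EuclideanSpace ℝ (Fin n) → ℝ)
    (x : EuclideanSpace ℝ (Fin n)) : ℝ :=
  ∑ i, grad n f x i ^ 2

/-- The shape operator of the graph of `f`, with respect to the upward unit normal: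
`W(x) = (1+|∇f|²)^{-1/2} (Iₙ - ∇f ∇fᵀ/(1+|∇f|²)) D²f(x)`. -/
noncomputable def shapeOp (n : ℕ) (f : EuclideanSpace ℝ (Fin n) → ℝ)
    (x : EuclideanSpace ℝ (Fin n)) : Matrix (Fin n) (Fin n) ℝ :=
  (Real.sqrt (1 + gradSq n f x))⁻¹ •
    (((1 : Matrix (Fin n) (Fin n) ℝ) -
      Matrix.of fun i j => grad n f x i * grad n f x j / (1 + gradSq n f x)) * hess n f x)

/-- The mean curvature `H(x) = tr W(x) / n`. -/
noncomputable def meanCurv (n : ℕ) (f : EuclideanSpace ℝ (Fin n) → ℝ)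
    (x : EuclideanSpace ℝ (Fin n)) : ℝ :=
  (shapeOp n f x).trace / n

/-- The scalar curvature `R(x) = ((tr W)² - tr(W²)) / (n(n-1))`. -/
noncomputable def scalarCurv (n : ℕ) (f : EuclideanSpace ℝ (Fin n) → ℝ)
    (x : EuclideanSpace ℝ (Fin n)) : ℝ :=
  ((shapeOp n f x).trace ^ 2 - (shapeOp n f x * shapeOp n f x).trace) /
    ((n : ℝ) * ((n : ℝ) - 1))

/-- The length `|A|(x) = √(tr(W(x)²))` of the second fundamental form. -/
noncomputable def normA (n : ℕ) (f : EuclideanSpace ℝ (Fin n) → ℝ)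
    (x : EuclideanSpace ℝ (Fin n)) : ℝ :=
  Real.sqrt ((shapeOp n f x * shapeOp n f x).trace)

open scoped MatrixOrder in
theorem Matrix.PosSemidef.exists_eq_conjTranspose_mul_self {ι : Type*} [Fintype ι] [DecidableEq ι]
    {S : Matrix ι ι ℝ} (hS : S.PosSemidef) : ∃ C : Matrix ι ι ℝ, S = C.conjTranspose * C :=
  CStarAlgebra.nonneg_iff_eq_star_mul_self.mp hS.nonneg

theorem Matrix.PosSemidef.trace_mul_self_le_trace_sq {ι : Type*} [Fintype ι] [DecidableEq ι]
    {S : Matrix ι ι ℝ} (hS : S.PosSemidef) : (S * S).trace ≤ S.trace ^ 2 := by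
  obtain ⟨C, rfl⟩ := hS.exists_eq_conjTranspose_mul_self
  have key : ∀ i j, (C.conjTranspose * C) i j * (C.conjTranspose * C) j i ≤
      (C.conjTranspose * C) i i * (C.conjTranspose * C) j j := by
    intro i j
    simp only [Matrix.mul_apply, Matrix.conjTranspose_apply, star_trivial]
    have h := Finset.sum_mul_sq_le_sq_mul_sq Finset.univ (fun k => C k i) (fun k => C k j)
    simp only [sq] at h
    simpa only [mul_comm (C _ j) (C _ i)] using h
  rw [sq, Matrix.trace, Matrix.trace, Finset.sum_mul_sum]
  refine Finset.sum_le_sum fun i _ => ?_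
  rw [Matrix.diag_apply, Matrix.mul_apply]
  exact Finset.sum_le_sum fun j _ => key i j

theorem Matrix.PosSemidef.trace_mul_mul_mul_le {ι : Type*} [Fintype ι] [DecidableEq ι]
    {P Q : Matrix ι ι ℝ} (hP : P.PosSemidef) (hQ : Q.PosSemidef) :
    0 ≤ (P * Q).trace ∧ (P * Q * (P * Q)).trace ≤ (P * Q).trace ^ 2 := by
  obtain ⟨B, rfl⟩ := hP.exists_eq_conjTranspose_mul_self
  have hS := hQ.mul_mul_conjTranspose_same B
  have h1 : (B.conjTranspose * B * Q).trace = (B * Q * B.conjTranspose).trace := by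
    rw [Matrix.mul_assoc, Matrix.trace_mul_comm]
  have h2 : (B.conjTranspose * B * Q * (B.conjTranspose * B * Q)).trace =
      (B * Q * B.conjTranspose * (B * Q * B.conjTranspose)).trace := by
    rw [Matrix.mul_assoc B.conjTranspose, Matrix.mul_assoc B.conjTranspose, Matrix.trace_mul_comm]
    simp only [Matrix.mul_assoc]
  rw [h1, h2]
  exact ⟨hS.trace_nonneg, hS.trace_mul_self_le_trace_sq⟩

/-- If `c • 1 - W` is a product of positive semidefinite matrices (so that the eigenvalues of `W`
are real and at most `c`) and `W` has nonnegative trace, then `tr (W²) < (n c)²`. -/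
theorem Matrix.trace_mul_self_lt_of_smul_one_sub_eq_mul {n : ℕ} (hn : 2 ≤ n) {c : ℝ} (hc : 0 < c)
    {W P Q : Matrix (Fin n) (Fin n) ℝ} (hP : P.PosSemidef) (hQ : Q.PosSemidef)
    (hW : c • (1 : Matrix (Fin n) (Fin n) ℝ) - W = P * Q) (htr : 0 ≤ W.trace) :
    (W * W).trace < (n * c) ^ 2 := by
  obtain ⟨h0, h1⟩ := hP.trace_mul_mul_mul_le hQ
  rw [← hW] at h0 h1
  have e1 : (c • (1 : Matrix (Fin n) (Fin n) ℝ) - W).trace = n * c - W.trace := by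
    simp [Matrix.trace_sub, Matrix.trace_smul, mul_comm]
  have e2 : ((c • (1 : Matrix (Fin n) (Fin n) ℝ) - W) *
      (c • (1 : Matrix (Fin n) (Fin n) ℝ) - W)).trace =
      n * c ^ 2 - 2 * c * W.trace + (W * W).trace := by
    simp [sub_mul, mul_sub, Matrix.trace_sub, Matrix.trace_smul]
    ring
  rw [e1] at h0 h1
  rw [e2] at h1
  have hn' : (2 : ℝ) ≤ n := by exact_mod_cast hn
  have h3 : 0 ≤ W.trace * (n * c - W.trace) := mul_nonneg htr h0
  have h4 : 0 ≤ (n - 2 : ℝ) * (c * W.trace) := mul_nonneg (by linarith) (mul_nonneg hc.le htr)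
  nlinarith [mul_pos (by linarith : (0 : ℝ) < n) (pow_pos hc 2)]

theorem Matrix.posSemidef_one_sub_of_mul_div {ι : Type*} [Fintype ι] [DecidableEq ι] (g : ι → ℝ) :
    ((1 : Matrix ι ι ℝ) - Matrix.of fun i j => g i * g j / (1 + ∑ k, g k ^ 2)).PosSemidef := by
  have hs : 0 ≤ ∑ k, g k ^ 2 := Finset.sum_nonneg fun k _ => sq_nonneg _
  refine Matrix.PosSemidef.of_dotProduct_mulVec_nonneg ?_ fun x => ?_
  · ext i j
    simp [Matrix.one_apply, eq_comm, mul_comm]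
  · have h1 : star x ⬝ᵥ (((1 : Matrix ι ι ℝ) -
        Matrix.of fun i j => g i * g j / (1 + ∑ k, g k ^ 2)).mulVec x) =
        ∑ i, x i ^ 2 - (∑ i, g i * x i) ^ 2 / (1 + ∑ k, g k ^ 2) := by
      rw [Matrix.sub_mulVec, dotProduct_sub, Matrix.one_mulVec, sq (∑ i, g i * x i),
        Finset.sum_mul_sum, Finset.sum_div]
      congr 1
      · simp [dotProduct, sq]
      · simp only [dotProduct, Matrix.mulVec, Matrix.of_apply, Finset.mul_sum, Finset.sum_div,
          Pi.star_apply, star_trivial]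
        exact Finset.sum_congr rfl fun i _ => Finset.sum_congr rfl fun j _ => by ring
    rw [h1, sub_nonneg, div_le_iff₀ (by linarith)]
    have := Finset.sum_mul_sq_le_sq_mul_sq Finset.univ g x
    nlinarith [Finset.sum_nonneg fun i (_ : i ∈ Finset.univ) => sq_nonneg (x i)]

theorem IsLocalMax.second_deriv_nonpos {φ φ' : ℝ → ℝ} {φ'' x : ℝ} (h : IsLocalMax φ x)
    (h1 : ∀ᶠ t in nhds x, HasDerivAt φ (φ' t) t) (h2 : HasDerivAt φ' φ'' x) : φ'' ≤ 0 := by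
  have e : deriv φ =ᶠ[nhds x] φ' := h1.mono fun t ht => ht.deriv
  have e2 : deriv (deriv φ) x = φ'' := by rw [e.deriv_eq, h2.deriv]
  by_contra! hpos
  have hmin := isLocalMin_of_deriv_deriv_pos (e2 ▸ hpos) h.deriv_eq_zero
    h1.self_of_nhds.continuousAt
  have hc : φ =ᶠ[nhds x] fun _ => φ x := by
    filter_upwards [h, hmin] with t ht ht' using le_antisymm ht ht'
  have : deriv (deriv φ) x = 0 := by rw [hc.deriv.deriv_eq]; simp
  linarith

section
variable {E : Type*} [NormedAddCommGroup E] [InnerProductSpace ℝ E]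

theorem IsLocalMax.fderiv_and_second_fderiv_of_add_sqrt {f : E → ℝ} (hf : ContDiff ℝ 2 f)
    {r : ℝ} {p : E} (hp : 0 < r ^ 2 - ‖p‖ ^ 2)
    (hmax : IsLocalMax (fun x => f x + √(r ^ 2 - ‖x‖ ^ 2)) p) (v : E) :
    √(r ^ 2 - ‖p‖ ^ 2) * fderiv ℝ f p v = inner ℝ p v ∧
    √(r ^ 2 - ‖p‖ ^ 2) * fderiv ℝ (fderiv ℝ f) p v v ≤ ‖v‖ ^ 2 + fderiv ℝ f p v ^ 2 := by
  set a := r ^ 2 - ‖p‖ ^ 2 with ha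
  set b := inner ℝ p v with hb
  set q : ℝ → ℝ := fun t => a - 2 * b * t - ‖v‖ ^ 2 * t ^ 2 with hq
  have hγ : ∀ t : ℝ, HasDerivAt (fun t : ℝ => p + t • v) v t := fun t => by
    simpa using ((hasDerivAt_id t).smul_const v).const_add p
  have hqe : ∀ t : ℝ, r ^ 2 - ‖p + t • v‖ ^ 2 = q t := fun t => by
    rw [norm_add_sq_real, inner_smul_right, norm_smul, mul_pow, Real.norm_eq_abs, sq_abs]
    simp only [hq, ha, hb]; ring
  have hqd : ∀ t : ℝ, HasDerivAt q (-(2 * b) - ‖v‖ ^ 2 * (2 * t)) t := fun t => by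
    have := (((hasDerivAt_id t).const_mul (2 * b)).const_sub a).sub
      (((hasDerivAt_id t).pow 2).const_mul (‖v‖ ^ 2))
    refine this.congr_deriv ?_
    simp
  have hq0 : q 0 = a := by simp [hq]
  have hqpos : ∀ᶠ t in nhds (0 : ℝ), 0 < q t :=
    (hqd 0).continuousAt.eventually (lt_mem_nhds (by rwa [hq0]))
  set φ : ℝ → ℝ := fun t => f (p + t • v) + √(q t)
  have hφ : IsLocalMax φ 0 := by
    have hc : Filter.Tendsto (fun t : ℝ => p + t • v) (nhds 0) (nhds p) := by
      simpa using (hγ 0).continuousAt.tendsto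
    filter_upwards [hc.eventually hmax] with t ht
    simpa [φ, hqe, hq0, ← ha] using ht
  have hd : ∀ t, 0 < q t → HasDerivAt φ
      (fderiv ℝ f (p + t • v) v + (-(2 * b) - ‖v‖ ^ 2 * (2 * t)) / (2 * √(q t))) t := by
    intro t ht
    exact (((hf.differentiable (by norm_num)) _).hasFDerivAt.comp_hasDerivAt t (hγ t)).add
      ((hqd t).sqrt ht.ne')
  have hsa : 0 < √a := Real.sqrt_pos.2 hp
  have hsa2 : √a ^ 2 = a := Real.sq_sqrt hp.le
  have h1 : fderiv ℝ f p v = b / √a := by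
    have := hφ.hasDerivAt_eq_zero (hd 0 (by rwa [hq0]))
    simp only [zero_smul, add_zero, hq0] at this
    field_simp at this ⊢
    linarith
  have hD : HasDerivAt (fun t : ℝ => fderiv ℝ f (p + t • v) v)
      (fderiv ℝ (fderiv ℝ f) p v v) 0 := by
    have hdf : Differentiable ℝ (fderiv ℝ f) :=
      (hf.fderiv_right (m := 1) (by norm_num)).differentiable (by norm_num)
    have h0 : HasFDerivAt (fderiv ℝ f) (fderiv ℝ (fderiv ℝ f) p) (p + (0 : ℝ) • v) := by
      simpa using (hdf p).hasFDerivAt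
    have h1 : HasDerivAt (fun t : ℝ => fderiv ℝ f (p + t • v)) (fderiv ℝ (fderiv ℝ f) p v) 0 :=
      h0.comp_hasDerivAt (0 : ℝ) (hγ 0)
    exact (h1.clm_apply (hasDerivAt_const (0 : ℝ) v)).congr_deriv (by simp)
  have hN : HasDerivAt (fun t : ℝ => -(2 * b) - ‖v‖ ^ 2 * (2 * t)) (-(2 * ‖v‖ ^ 2)) 0 := by
    have := (((hasDerivAt_id (0 : ℝ)).const_mul 2).const_mul (‖v‖ ^ 2)).const_sub (-(2 * b))
    exact this.congr_deriv (by ring)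
  have hs := ((hqd 0).sqrt (by rw [hq0]; exact hp.ne')).const_mul 2
  have h2 := hφ.second_deriv_nonpos (hqpos.mono hd)
    (hD.add (hN.div hs (by rw [hq0]; positivity)))
  simp only [hq0] at h2
  refine ⟨by rw [h1]; field_simp, ?_⟩
  have h3 : fderiv ℝ (fderiv ℝ f) p v v - ‖v‖ ^ 2 / √a - b ^ 2 / √a ^ 3 ≤ 0 := by
    refine le_of_eq_of_le ?_ h2
    field_simp
    ring
  rw [h1]
  have h4 := mul_nonpos_of_nonneg_of_nonpos hsa.le h3
  have h5 : √a * (fderiv ℝ (fderiv ℝ f) p v v - ‖v‖ ^ 2 / √a - b ^ 2 / √a ^ 3) =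
    √a * fderiv ℝ (fderiv ℝ f) p v v - (‖v‖ ^ 2 + (b / √a) ^ 2) := by
    field_simp
    ring
  linarith

theorem exists_isLocalMax_add_sqrt [FiniteDimensional ℝ E] {f : E → ℝ} (hf : Differentiable ℝ f)
    {r : ℝ} (hr : 0 < r) :
    ∃ p ∈ ball (0 : E) r, IsLocalMax (fun x => f x + √(r ^ 2 - ‖x‖ ^ 2)) p := by
  set F : E → ℝ := fun x => f x + √(r ^ 2 - ‖x‖ ^ 2) with hF
  have : ProperSpace E := FiniteDimensional.proper_real E
  have hFc : Continuous F := hf.continuous.add (by fun_prop)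
  obtain ⟨p, hp, hmax⟩ := (isCompact_closedBall (0 : E) r).exists_isMaxOn
    (nonempty_closedBall.2 hr.le) hFc.continuousOn
  have hpb : p ∈ ball (0 : E) r := by
    rw [mem_closedBall_zero_iff] at hp
    rw [mem_ball_zero_iff]
    refine lt_of_le_of_ne hp fun hpr => ?_
    set d := fderiv ℝ f p p
    have hder : HasDerivAt (fun s : ℝ => f (p - s • p)) (-d) 0 := by
      have hγ : HasDerivAt (fun s : ℝ => p - s • p) (-p) 0 := by
        simpa using ((hasDerivAt_id (0 : ℝ)).smul_const p).const_sub p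
      have h0 : HasFDerivAt f (fderiv ℝ f p) (p - (0 : ℝ) • p) := by
        simpa using (hf p).hasFDerivAt
      have h1 := h0.comp_hasDerivAt (0 : ℝ) hγ
      rwa [map_neg] at h1
    -- along the inward radius, `F` gains `r √s` while `f` loses at most `O(s)`
    have hev : ∀ᶠ s in nhds (0 : ℝ), f p - (|d| + 1) * |s| ≤ f (p - s • p) := by
      have := hder.isLittleO.def one_pos
      filter_upwards [this] with s hs
      simp only [zero_smul, sub_zero, smul_eq_mul, Real.norm_eq_abs, one_mul] at hs
      have h1 := (abs_le.1 hs).1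
      have h2 := abs_mul s d ▸ neg_abs_le (s * d)
      have h3 := abs_mul s d ▸ le_abs_self (s * d)
      nlinarith
    have hsm : ∀ᶠ s in nhds (0 : ℝ), s < min 1 ((r / (|d| + 1)) ^ 2) :=
      gt_mem_nhds (by positivity)
    obtain ⟨s, ⟨hs1, hs2⟩, hs0⟩ := ((hev.and hsm).filter_mono nhdsWithin_le_nhds).and
      (self_mem_nhdsWithin (s := Set.Ioi (0 : ℝ))) |>.exists
    rw [lt_min_iff] at hs2
    have hnorm : ‖p - s • p‖ = (1 - s) * r := by
      have : p - s • p = (1 - s) • p := by rw [sub_smul, one_smul]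
      rw [this, norm_smul, hpr, Real.norm_eq_abs, abs_of_pos (by linarith)]
    have hle : F (p - s • p) ≤ F p := hmax (by
      rw [mem_closedBall_zero_iff, hnorm]
      nlinarith)
    have hss : 0 < √s := Real.sqrt_pos.2 hs0
    have hss2 : √s * √s = s := Real.mul_self_sqrt hs0.le
    have hsq : r * √s ≤ √(r ^ 2 - ((1 - s) * r) ^ 2) := by
      refine Real.le_sqrt_of_sq_le ?_
      rw [mul_pow, Real.sq_sqrt hs0.le]
      nlinarith [mul_nonneg (mul_nonneg hs0.le (by linarith : 0 ≤ 1 - s)) (sq_nonneg r)]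
    simp only [hF, hnorm, hpr, sub_self, Real.sqrt_zero, add_zero] at hle
    rw [abs_of_pos hs0] at hs1
    have hlt : √s < r / (|d| + 1) := by
      rw [Real.sqrt_lt' (by positivity)]
      exact hs2.2
    rw [lt_div_iff₀ (by positivity)] at hlt
    nlinarith [mul_lt_mul_of_pos_left hlt hss]
  exact ⟨p, hpb, hmax.isLocalMax (Filter.mem_of_superset (isOpen_ball.mem_nhds hpb)
    ball_subset_closedBall)⟩

end

theorem EuclideanSpace.eq_sum_smul_single {ι : Type*} [Fintype ι] [DecidableEq ι]
    (v : EuclideanSpace ℝ ι) : v = ∑ i, v i • EuclideanSpace.single i (1 : ℝ) := by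
  ext j
  simp [Pi.single_apply]

theorem fderiv_eq_sum_grad {n : ℕ} (f : EuclideanSpace ℝ (Fin n) → ℝ)
    (x v : EuclideanSpace ℝ (Fin n)) : fderiv ℝ f x v = ∑ i, grad n f x i * v i := by
  conv_lhs => rw [EuclideanSpace.eq_sum_smul_single v]
  simp [grad, mul_comm]

theorem hess_apply {n : ℕ} {f : EuclideanSpace ℝ (Fin n) → ℝ} (hf : ContDiff ℝ 2 f)
    (x : EuclideanSpace ℝ (Fin n)) (i j : Fin n) :
    hess n f x i j = fderiv ℝ (fderiv ℝ f) x (EuclideanSpace.single i 1)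
      (EuclideanSpace.single j 1) := by
  have hdf : DifferentiableAt ℝ (fderiv ℝ f) x :=
    (hf.fderiv_right (m := 1) (by norm_num)).differentiable (by norm_num) x
  rw [hess, Matrix.of_apply, fderiv_clm_apply hdf (differentiableAt_const _)]
  simp

theorem hess_isHermitian {n : ℕ} {f : EuclideanSpace ℝ (Fin n) → ℝ} (hf : ContDiff ℝ 2 f)
    (x : EuclideanSpace ℝ (Fin n)) : (hess n f x).IsHermitian := by
  ext i j
  rw [Matrix.conjTranspose_apply, star_trivial, hess_apply hf, hess_apply hf]
  exact (hf.contDiffAt.isSymmSndFDerivAt (by simp)) _ _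

theorem dotProduct_hess_mulVec {n : ℕ} {f : EuclideanSpace ℝ (Fin n) → ℝ} (hf : ContDiff ℝ 2 f)
    (x v : EuclideanSpace ℝ (Fin n)) :
    v.ofLp ⬝ᵥ (hess n f x).mulVec v.ofLp = fderiv ℝ (fderiv ℝ f) x v v := by
  conv_rhs => rw [EuclideanSpace.eq_sum_smul_single v]
  simp only [map_sum, map_smul, _root_.sum_apply, smul_apply,
    smul_eq_mul, ← hess_apply hf, dotProduct, Matrix.mulVec, Finset.mul_sum]
  rw [Finset.sum_comm]
  exact Finset.sum_congr rfl fun i _ => Finset.sum_congr rfl fun j _ => by ring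

theorem shapeOp_neg (n : ℕ) (f : EuclideanSpace ℝ (Fin n) → ℝ) (x : EuclideanSpace ℝ (Fin n)) :
    shapeOp n (-f) x = -shapeOp n f x := by
  have h1 : ∀ y i, grad n (-f) y i = -grad n f y i := fun y i => by simp [grad, fderiv_neg]
  have h2 : gradSq n (-f) x = gradSq n f x := by simp [gradSq, h1]
  have h3 : hess n (-f) x = -hess n f x := by
    ext i j
    have : (fun y => fderiv ℝ (-f) y (EuclideanSpace.single j 1)) =
        -fun y => fderiv ℝ f y (EuclideanSpace.single j 1) := funext fun y => h1 y j
    rw [hess, Matrix.of_apply, this, fderiv_neg, neg_apply]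
    rfl
  simp [shapeOp, h1, h2, h3]

theorem Matrix.one_sub_of_mul_div_mul_one_add {ι : Type*} [Fintype ι] [DecidableEq ι]
    (g : ι → ℝ) :
    ((1 : Matrix ι ι ℝ) - Matrix.of fun i j => g i * g j / (1 + ∑ k, g k ^ 2)) *
      (1 + Matrix.of fun i j => g i * g j) = 1 := by
  have hs : 0 ≤ ∑ k, g k ^ 2 := Finset.sum_nonneg fun k _ => sq_nonneg _
  have hs' : 1 + ∑ k, g k ^ 2 ≠ 0 := by linarith
  have h : (Matrix.of fun i j => g i * g j / (1 + ∑ k, g k ^ 2)) *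
      (Matrix.of fun i j => g i * g j) =
      (∑ k, g k ^ 2) • Matrix.of fun i j => g i * g j / (1 + ∑ k, g k ^ 2) := by
    ext i j
    simp only [Matrix.mul_apply, Matrix.of_apply, Matrix.smul_apply, smul_eq_mul,
      Finset.sum_mul]
    exact Finset.sum_congr rfl fun k _ => by ring
  have h' : (Matrix.of fun i j => g i * g j : Matrix ι ι ℝ) =
      (1 + ∑ k, g k ^ 2) • Matrix.of fun i j => g i * g j / (1 + ∑ k, g k ^ 2) := by
    ext i j
    simp only [Matrix.of_apply, Matrix.smul_apply, smul_eq_mul]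
    field_simp
  rw [sub_mul, mul_add, mul_add, h, mul_one, mul_one, one_mul]
  nth_rewrite 1 [h']
  rw [add_smul, one_smul]
  abel

/-- At a point where a lower hemisphere of radius `r` touches the graph of `f` from above, the
principal curvatures of the graph are at most `1 / r`. -/
theorem exists_posSemidef_of_isLocalMax_add_sqrt {n : ℕ} {f : EuclideanSpace ℝ (Fin n) → ℝ}
    (hf : ContDiff ℝ 2 f) {r : ℝ} (hr : 0 < r) {p : EuclideanSpace ℝ (Fin n)} (hp : p ∈ ball 0 r)
    (hmax : IsLocalMax (fun x => f x + √(r ^ 2 - ‖x‖ ^ 2)) p) :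
    ∃ P Q : Matrix (Fin n) (Fin n) ℝ, P.PosSemidef ∧ Q.PosSemidef ∧
      r⁻¹ • (1 : Matrix (Fin n) (Fin n) ℝ) - shapeOp n f p = P * Q := by
  rw [mem_ball_zero_iff] at hp
  have ha : 0 < r ^ 2 - ‖p‖ ^ 2 := by
    have := norm_nonneg p
    nlinarith
  have key := hmax.fderiv_and_second_fderiv_of_add_sqrt hf ha
  set k := √(r ^ 2 - ‖p‖ ^ 2)
  have hk : 0 < k := Real.sqrt_pos.2 ha
  have hk2 : k ^ 2 = r ^ 2 - ‖p‖ ^ 2 := Real.sq_sqrt ha.le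
  have hg : ∀ i, grad n f p i = p i / k := fun i => by
    have := (key (EuclideanSpace.single i 1)).1
    rw [EuclideanSpace.inner_single_right] at this
    rw [eq_div_iff hk.ne', mul_comm]
    simpa [grad] using this
  have hs : 1 + gradSq n f p = (r / k) ^ 2 := by
    simp only [gradSq, hg, div_pow]
    rw [← Finset.sum_div, ← EuclideanSpace.real_norm_sq_eq, eq_div_iff (by positivity), add_mul,
      div_mul_cancel₀ _ (by positivity), hk2]
    ring
  have hw : (√(1 + gradSq n f p))⁻¹ = r⁻¹ * k := by
    rw [hs, Real.sqrt_sq (by positivity), inv_div, div_eq_inv_mul]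
  refine ⟨_, r⁻¹ • ((1 + Matrix.of fun i j => grad n f p i * grad n f p j) - k • hess n f p),
    Matrix.posSemidef_one_sub_of_mul_div (grad n f p), ?_, ?_⟩
  · refine Matrix.PosSemidef.smul ?_ (by positivity)
    refine Matrix.PosSemidef.of_dotProduct_mulVec_nonneg ?_ fun x => ?_
    · refine (Matrix.isHermitian_one.add ?_).sub ?_
      · ext i j
        simp [mul_comm]
      · rw [Matrix.IsHermitian, Matrix.conjTranspose_smul, hess_isHermitian hf, star_trivial]
    · have h := (key (WithLp.toLp 2 x)).2
      rw [← dotProduct_hess_mulVec hf, fderiv_eq_sum_grad, EuclideanSpace.real_norm_sq_eq,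
        sq (∑ i, _), Finset.sum_mul_sum] at h
      rw [Matrix.sub_mulVec, Matrix.add_mulVec, Matrix.one_mulVec, Matrix.smul_mulVec,
        dotProduct_sub, dotProduct_add, dotProduct_smul, star_trivial, smul_eq_mul, sub_nonneg]
      refine h.trans_eq ?_
      congr 1
      · simp [dotProduct, sq]
      · simp only [dotProduct, Matrix.mulVec, Matrix.of_apply, Finset.mul_sum]
        exact Finset.sum_congr rfl fun i _ => Finset.sum_congr rfl fun j _ => by ring
  · rw [shapeOp, hw, Matrix.mul_smul, mul_sub, Matrix.one_sub_of_mul_div_mul_one_add, smul_sub,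
      Matrix.mul_smul, smul_smul]
    rfl

theorem exists_normA_lt_of_meanCurv_nonneg {n : ℕ} (hn : 2 ≤ n) {r : ℝ} (hr : 0 < r)
    {f : EuclideanSpace ℝ (Fin n) → ℝ} (hf : ContDiff ℝ 2 f)
    (hH : ∀ x ∈ closedBall (0 : EuclideanSpace ℝ (Fin n)) r, 0 ≤ meanCurv n f x) :
    ∃ p ∈ closedBall (0 : EuclideanSpace ℝ (Fin n)) r, normA n f p < n / r := by
  obtain ⟨p, hp, hmax⟩ := exists_isLocalMax_add_sqrt (hf.differentiable (by norm_num)) hr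
  obtain ⟨P, Q, hP, hQ, hW⟩ := exists_posSemidef_of_isLocalMax_add_sqrt hf hr hp hmax
  have hn0 : (0 : ℝ) < n := by exact_mod_cast (by omega : 0 < n)
  have htr : 0 ≤ (shapeOp n f p).trace := by
    have := mul_nonneg (hH p (ball_subset_closedBall hp)) hn0.le
    rwa [meanCurv, div_mul_cancel₀ _ hn0.ne'] at this
  refine ⟨p, ball_subset_closedBall hp, ?_⟩
  rw [normA, Real.sqrt_lt' (by positivity), div_eq_mul_inv]
  exact Matrix.trace_mul_self_lt_of_smul_one_sub_eq_mul hn (inv_pos.2 hr) hP hQ hW htr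

/-- **Theorem 4.** If the mean curvature of a graph over the closed ball of radius
`r` in `ℝⁿ` does not change sign, then `inf |A| < n/r`. -/
theorem inf_normA_lt_of_meanCurv_sign_closedBall
    (n : ℕ) (hn : 2 ≤ n) (r : ℝ) (hr : 0 < r)
    (f : EuclideanSpace ℝ (Fin n) → ℝ) (hf : ContDiff ℝ 2 f)
    (hH : (∀ x ∈ closedBall (0 : EuclideanSpace ℝ (Fin n)) r, 0 ≤ meanCurv n f x) ∨
          (∀ x ∈ closedBall (0 : EuclideanSpace ℝ (Fin n)) r, meanCurv n f x ≤ 0)) :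
    sInf ((fun x => normA n f x) '' closedBall (0 : EuclideanSpace ℝ (Fin n)) r)
      < (n : ℝ) / r := by
  have hlt : ∃ p ∈ closedBall (0 : EuclideanSpace ℝ (Fin n)) r, normA n f p < n / r := by
    rcases hH with hH | hH
    · exact exists_normA_lt_of_meanCurv_nonneg hn hr hf hH
    · obtain ⟨p, hp, h⟩ := exists_normA_lt_of_meanCurv_nonneg (f := -f) hn hr hf.neg fun x hx => by
        simpa [meanCurv, shapeOp_neg, neg_div] using hH x hx
      exact ⟨p, hp, by simpa [normA, shapeOp_neg] using h⟩
  obtain ⟨p, hp, h⟩ := hlt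
  refine (csInf_le ⟨0, ?_⟩ (Set.mem_image_of_mem _ hp)).trans_lt h
  rintro _ ⟨x, -, rfl⟩
  exact Real.sqrt_nonneg _
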